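/- arXiv:2601.19780 — 2 statements merged into one kernel-verified Lean document; each statement's English description precedes it below -/
import Mathlib

section
/- Let L be an exceptional odd unimodular integral lattice of rank n with n ≡ 2, 3 or 4 (mod 8) and containing no vector of norm 1. Then the subgroup W(L)^± of O(L) generated by −id and the reflections along roots of L acts transitively on Exc L, the set of characteristic vectors of L of norm < 8. -/
open Matrix

/-- The group `W(L)^±` of the lattice `ℤⁿ` with Gram matrix `P`: the subgroup of linear
automorphisms generated by `−id` together with the reflections `sₐ(x) = x − (x·α)•α`
along the roots `α` (vectors of norm 2). -/
def weylPM {n : ℕ} (P : Matrix (Fin n) (Fin n) ℤ) :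
    Subgroup ((Fin n → ℤ) ≃ₗ[ℤ] (Fin n → ℤ)) :=
  Subgroup.closure
    ({σ | ∃ α : Fin n → ℤ, α ⬝ᵥ P *ᵥ α = 2 ∧ ∀ x, σ x = x - (x ⬝ᵥ P *ᵥ α) • α} ∪
      {σ | ∀ x, σ x = -x})


section GaussPart
open Complex Filter Topology

lemma theta_tendsto_one (x y : ℝ) :
    Tendsto (fun δ : ℝ => jacobiTheta₂ (x : ℂ) (I / δ + y)) (𝓝[>] 0) (𝓝 1) := by
  have h1 : ∑' n : ℤ, (if n = 0 then (1:ℂ) else 0) = 1 := by simp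
  rw [← h1]
  have hs : Summable (fun n : ℤ => ‖jacobiTheta₂_term n 0 I‖) :=
    ((summable_jacobiTheta₂_term_iff 0 I).2 (by simp)).norm
  have him : ∀ δ : ℝ, (I / δ + y : ℂ).im = δ⁻¹ := by
    intro δ
    have : (I / δ + y : ℂ) = ((δ⁻¹ : ℝ) : ℂ) * I + y := by push_cast; ring
    rw [this]; simp
  have hnorm : ∀ (n : ℤ) (δ : ℝ), ‖jacobiTheta₂_term n (x:ℂ) (I / δ + y)‖
      = Real.exp (-Real.pi * n ^ 2 * δ⁻¹) := by
    intro n δ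
    rw [norm_jacobiTheta₂_term, him]; simp
  unfold jacobiTheta₂
  refine tendsto_tsum_of_dominated_convergence hs ?_ ?_
  · intro n
    by_cases hn : n = 0
    · subst hn
      simp [jacobiTheta₂_term]
    · simp only [hn, if_false]
      rw [tendsto_zero_iff_norm_tendsto_zero]
      simp_rw [hnorm]
      refine Real.tendsto_exp_atBot.comp ?_
      refine Tendsto.const_mul_atTop_of_neg ?_ tendsto_inv_nhdsGT_zero
      have : (0:ℝ) < (n:ℝ)^2 := by positivity
      nlinarith [Real.pi_pos]
  · have : Set.Ioc (0:ℝ) 1 ∈ 𝓝[>] (0:ℝ) := Ioc_mem_nhdsGT one_pos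
    filter_upwards [this] with δ hδ n
    rw [hnorm, norm_jacobiTheta₂_term]
    apply Real.exp_le_exp.2
    have h1 : 1 ≤ δ⁻¹ := (one_le_inv₀ hδ.1).2 hδ.2
    have h2 : 0 ≤ Real.pi * (n:ℝ)^2 := by positivity
    simp
    nlinarith

lemma theta_split (a b : ℕ) [NeZero a] (hab : a = 2 * b) (z : ℂ) (hz : 0 < z.re) :
    jacobiTheta₂ 0 (1 / a + I * z) =
      ∑ k : Fin a, cexp (Real.pi * I * (k : ℕ) ^ 2 / a) * (cexp (-Real.pi * z * (k : ℕ) ^ 2) *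
        jacobiTheta₂ (I * z * (k : ℕ) * a) (I * z * a ^ 2)) := by
  have ha : (a : ℂ) ≠ 0 := Nat.cast_ne_zero.2 (NeZero.ne a)
  have ha' : (0:ℝ) < a := Nat.cast_pos.2 (Nat.pos_of_ne_zero (NeZero.ne a))
  have him : 0 < (1 / a + I * z : ℂ).im := by
    have : (1 / (a:ℂ)) = ((1 / (a:ℝ) : ℝ) : ℂ) := by push_cast; rfl
    rw [add_im, this, ofReal_im]; simpa using hz
  have hs := (summable_jacobiTheta₂_term_iff 0 _).2 him
  have him2 : 0 < (I * z * a ^ 2 : ℂ).im := by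
    have : (I * z * a ^ 2 : ℂ) = ((a ^ 2 : ℝ) : ℂ) * (I * z) := by push_cast; ring
    rw [this, im_ofReal_mul]
    have : (I * z).im = z.re := by simp
    rw [this]; positivity
  unfold jacobiTheta₂
  have hs' := ((Int.divModEquiv a).symm.summable_iff).2 hs
  rw [← (Int.divModEquiv a).symm.tsum_eq]
  have hs2 := ((Equiv.prodComm (Fin a) ℤ).summable_iff).2 hs'
  rw [← (Equiv.prodComm (Fin a) ℤ).tsum_eq]
  refine (Summable.tsum_prod hs2).trans ?_
  rw [tsum_fintype]
  refine Finset.sum_congr rfl fun k _ => ?_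
  rw [← mul_assoc, ← tsum_mul_left]
  refine tsum_congr fun m => ?_
  simp only [jacobiTheta₂_term, Equiv.prodComm_apply, Function.comp, Prod.swap, Int.divModEquiv_symm_apply]
  rw [← Complex.exp_add, ← Complex.exp_add, Complex.exp_eq_exp_iff_exists_int]
  refine ⟨k * m + b * m ^ 2, ?_⟩
  have hab' : (a : ℂ) = 2 * b := by rw [hab]; push_cast; ring
  have hb : (b : ℂ) ≠ 0 := by rintro h; apply ha; rw [hab', h, mul_zero]
  push_cast
  rw [hab']
  field_simp
  ring_nf
  try simp only [I_sq]
  try ring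

lemma theta_period (b : ℕ) (τ : ℂ) : jacobiTheta₂ 0 (τ + 2 * b) = jacobiTheta₂ 0 τ := by
  induction b with
  | zero => simp
  | succ b ih =>
    rw [← ih, ← jacobiTheta₂_add_right 0 (τ + 2 * b)]; congr 1; push_cast; ring

lemma gauss_key (a b : ℕ) [NeZero a] (hab : a = 2 * b) (δ : ℝ) (hδ : 0 < δ) :
    ∑ k : Fin a, cexp (Real.pi * I * (k : ℕ) ^ 2 / a) *
        jacobiTheta₂ (((k : ℕ) / a : ℝ) : ℂ) (I / δ + ((1 / a : ℝ) : ℂ)) =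
      ((a : ℂ) / (a - I * δ)) ^ (1 / 2 : ℂ) / (1 / (δ + I * a)) ^ (1 / 2 : ℂ) *
        jacobiTheta₂ ((0 : ℝ) : ℂ) (I / δ + ((0:ℝ) : ℂ)) := by
  have ha : (a : ℂ) ≠ 0 := Nat.cast_ne_zero.2 (NeZero.ne a)
  have ha' : (0:ℝ) < a := Nat.cast_pos.2 (Nat.pos_of_ne_zero (NeZero.ne a))
  have hd : (δ : ℂ) ≠ 0 := by exact_mod_cast hδ.ne'
  have h1 : (a - I * δ : ℂ) ≠ 0 := by
    intro h
    have := congrArg Complex.re h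
    simp at this
    exact NeZero.ne a this
  have h2 : (δ + I * a : ℂ) ≠ 0 := by
    intro h
    have := congrArg Complex.re h
    simp at this
    exact hδ.ne' this
  have h12 : (δ + I * a : ℂ) = I * (a - I * δ) := by ring_nf; rw [I_sq]; ring
  set z : ℂ := δ / (a * (a - I * δ)) with hzdef
  have hz0 : z ≠ 0 := div_ne_zero hd (mul_ne_zero ha h1)
  have hza : z * a ^ 2 = ((δ : ℝ) : ℂ) * ((a : ℂ) / (a - I * δ)) := by
    rw [hzdef]; field_simp
  have hzre : 0 < z.re := by
    have : z = ((δ / a : ℝ) : ℂ) * (a - I * δ)⁻¹ := by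
      rw [hzdef]; push_cast; field_simp
    rw [this, re_ofReal_mul, inv_re]
    have h3 : (a - I * δ : ℂ).re = a := by simp
    rw [h3]
    have := normSq_pos.2 h1
    positivity
  have hτ : (1 / a + I * z : ℂ) = 1 / (a - I * δ) := by
    rw [hzdef]; field_simp; ring
  have e1 := theta_split a b hab z hzre
  have e2 : ∀ k : Fin a, cexp (-Real.pi * z * (k : ℕ) ^ 2) *
        jacobiTheta₂ (I * z * (k : ℕ) * a) (I * z * a ^ 2) =
        1 / (z * a ^ 2) ^ (1 / 2 : ℂ) * jacobiTheta₂ (((k : ℕ) / a : ℝ) : ℂ) (I / δ + ((1 / a : ℝ) : ℂ)) := by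
    intro k
    rw [jacobiTheta₂_functional_equation]
    have c1 : -I * (I * z * a ^ 2) = z * a ^ 2 := by
      ring_nf; rw [I_sq]; ring
    have c2 : (I * z * (k : ℕ) * a) / (I * z * a ^ 2) = (((k : ℕ) / a : ℝ) : ℂ) := by
      push_cast; field_simp
    have c3 : -1 / (I * z * a ^ 2) = I / δ + ((1 / a : ℝ) : ℂ) := by
      rw [hzdef]; push_cast; field_simp; ring_nf; simp only [I_sq]; ring
    have c4 : -Real.pi * I * (I * z * (k : ℕ) * a) ^ 2 / (I * z * a ^ 2) = Real.pi * z * (k : ℕ) ^ 2 := by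
      field_simp; ring_nf; simp only [I_sq]; ring
    rw [c1, c2, c3, c4]
    rw [mul_comm (1 / _) (cexp _), ← mul_assoc, ← mul_assoc, ← Complex.exp_add]
    ring_nf; simp
  simp_rw [e2] at e1
  have e3 : jacobiTheta₂ 0 (1 / a + I * z : ℂ) = 1 / (1 / (δ + I * a)) ^ (1 / 2 : ℂ) *
      (1 / (δ : ℂ) ^ (1 / 2 : ℂ) * jacobiTheta₂ ((0 : ℝ) : ℂ) (I / δ + ((0:ℝ) : ℂ))) := by
    rw [hτ, jacobiTheta₂_functional_equation]
    have c1 : -I * (1 / (a - I * δ)) = 1 / (δ + I * a) := by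
      rw [h12]; field_simp; rw [I_sq]; ring
    have c2 : -1 / (1 / (a - I * δ)) = I * δ - a := by
      field_simp; ring
    rw [c1, c2, zero_div, ← theta_period b (I * δ - a)]
    have c3 : (I * δ - a + 2 * b : ℂ) = I * δ := by rw [hab]; push_cast; ring
    rw [c3, jacobiTheta₂_functional_equation 0 (I * δ)]
    have c4 : -I * (I * δ) = (δ : ℂ) := by ring_nf; rw [I_sq]; ring
    have c5 : -1 / (I * δ) = I / δ + ((0:ℝ) : ℂ) := by
      push_cast; field_simp; ring_nf; rw [I_sq]
    rw [c4, c5]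
    simp
  have hq : ((a : ℂ) / (a - I * δ)) ≠ 0 := div_ne_zero ha h1
  have hcp : (((δ : ℝ) : ℂ) * ((a : ℂ) / (a - I * δ))) ^ (1 / 2 : ℂ) =
      (δ : ℂ) ^ (1 / 2 : ℂ) * ((a : ℂ) / (a - I * δ)) ^ (1 / 2 : ℂ) := by
    rw [cpow_def_of_ne_zero (mul_ne_zero hd hq), cpow_def_of_ne_zero hd, cpow_def_of_ne_zero hq,
      Complex.log_ofReal_mul hδ hq, ← Complex.exp_add, Complex.ofReal_log hδ.le]
    ring_nf
  rw [e3, hza, hcp] at e1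
  have n1 : (δ : ℂ) ^ (1 / 2 : ℂ) ≠ 0 := by rw [cpow_def_of_ne_zero hd]; exact exp_ne_zero _
  have n2 : ((a : ℂ) / (a - I * δ)) ^ (1 / 2 : ℂ) ≠ 0 := by
    rw [cpow_def_of_ne_zero hq]; exact exp_ne_zero _
  generalize (δ : ℂ) ^ (1 / 2 : ℂ) = A at *
  generalize ((a : ℂ) / (a - I * δ)) ^ (1 / 2 : ℂ) = B at *
  have e4 : ∀ k : Fin a, cexp (Real.pi * I * (k : ℕ) ^ 2 / a) *
        jacobiTheta₂ (((k : ℕ) / a : ℝ) : ℂ) (I / δ + ((1 / a : ℝ) : ℂ)) =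
        (A * B) * (cexp (Real.pi * I * (k : ℕ) ^ 2 / a) *
        (1 / (A * B) * jacobiTheta₂ (((k : ℕ) / a : ℝ) : ℂ) (I / δ + ((1 / a : ℝ) : ℂ)))) := by
    intro k; field_simp
  simp_rw [e4]
  rw [← Finset.mul_sum, ← e1]
  field_simp

lemma gauss_sum_fin (a b : ℕ) [NeZero a] (hab : a = 2 * b) :
    ∑ k : Fin a, cexp (Real.pi * I * (k : ℕ) ^ 2 / a) =
      ((Real.sqrt a : ℝ) : ℂ) * cexp (Real.pi * I / 4) := by
  have ha : (a : ℂ) ≠ 0 := Nat.cast_ne_zero.2 (NeZero.ne a)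
  have ha' : (0:ℝ) < a := Nat.cast_pos.2 (Nat.pos_of_ne_zero (NeZero.ne a))
  have L1 : Tendsto (fun δ : ℝ => ∑ k : Fin a, cexp (Real.pi * I * (k : ℕ) ^ 2 / a) *
        jacobiTheta₂ (((k : ℕ) / a : ℝ) : ℂ) (I / δ + ((1 / a : ℝ) : ℂ))) (𝓝[>] 0)
        (𝓝 (∑ k : Fin a, cexp (Real.pi * I * (k : ℕ) ^ 2 / a) * 1)) :=
    tendsto_finsetSum _ fun k _ => (theta_tendsto_one _ _).const_mul _
  have c0 : ContinuousAt (fun δ : ℝ => ((a : ℂ) / (a - I * δ)) ^ (1 / 2 : ℂ) /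
      (1 / (δ + I * a)) ^ (1 / 2 : ℂ)) 0 := by
    have hI : (1 / (((0:ℝ) : ℂ) + I * a)) = -I * ((1 / a : ℝ) : ℂ) := by
      push_cast; rw [zero_add]; field_simp; rw [I_sq]; ring
    refine ContinuousAt.div ?_ ?_ ?_
    · refine ContinuousAt.cpow ?_ continuousAt_const ?_
      · refine ContinuousAt.div continuousAt_const (by fun_prop) (by simpa using ha)
      · simp [ha]
    · refine ContinuousAt.cpow ?_ continuousAt_const ?_
      · refine ContinuousAt.div continuousAt_const (by fun_prop) (by simpa using ha)
      · rw [hI, mem_slitPlane_iff]; right; simp; exact NeZero.ne a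
    · rw [hI, cpow_def_of_ne_zero]
      · exact exp_ne_zero _
      · simpa using ha
  have L2 := (c0.tendsto.mono_left (nhdsWithin_le_nhds (s := Set.Ioi 0))).mul (theta_tendsto_one 0 0)
  have heq := eventually_of_mem (self_mem_nhdsWithin (a := (0:ℝ)) (s := Set.Ioi 0))
    (fun δ hδ => gauss_key a b hab δ hδ)
  have := tendsto_nhds_unique (L1.congr' heq) L2
  simp only [mul_one] at this
  rw [this]
  have hI : (1 / (((0:ℝ) : ℂ) + I * a)) = ((1 / a : ℝ) : ℂ) * -I := by
    push_cast; rw [zero_add]; field_simp; rw [I_sq]; ring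
  have hna : (0:ℝ) < 1 / a := by positivity
  rw [hI]
  have : ((a : ℂ) / (a - I * (0:ℝ))) = 1 := by simp [ha]
  rw [this, one_cpow, cpow_def_of_ne_zero (by simpa using ha), Complex.log_ofReal_mul hna (by simp),
    Complex.log_neg_I, one_div, ← Complex.exp_neg]
  have : ((Real.sqrt a : ℝ) : ℂ) = cexp (Real.log a / 2) := by
    rw [Real.sqrt_eq_rpow, Real.rpow_def_of_pos ha']; push_cast; ring_nf
  rw [this, ← Complex.exp_add]
  congr 1
  rw [one_div, Real.log_inv]; push_cast; ring

end GaussPart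

lemma ortho_exists {n : ℕ} (P : Matrix (Fin n) (Fin n) ℤ) (hsymm : P.IsSymm)
    (hpos : ∀ x : Fin n → ℤ, x ≠ 0 → 0 < x ⬝ᵥ P *ᵥ x) :
    ∃ (W : Matrix (Fin n) (Fin n) ℤ) (a : Fin n → ℕ), (∀ i, 0 < a i) ∧
      Wᵀ * P * W = Matrix.diagonal (fun i => (a i : ℤ)) := by
  let Pq : Matrix (Fin n) (Fin n) ℚ := P.map (Int.castRingHom ℚ)
  let B : LinearMap.BilinForm ℚ (Fin n → ℚ) := Matrix.toBilin' Pq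
  have hB : LinearMap.IsSymm B := by
    refine ⟨fun x y => ?_⟩
    simp only [B, Matrix.toBilin'_apply', RingHom.id_apply]
    have hP : Pqᵀ = Pq := by
      simp only [Pq, ← Matrix.transpose_map]; rw [hsymm]
    rw [Matrix.dotProduct_mulVec, ← Matrix.mulVec_transpose, hP, dotProduct_comm]
  have : Invertible (2:ℚ) := invertibleOfNonzero two_ne_zero
  obtain ⟨v0, hv0⟩ := LinearMap.BilinForm.exists_orthogonal_basis (B := B) hB
  have hfr : Module.finrank ℚ (Fin n → ℚ) = n := by simp
  let v := fun i : Fin n => v0 (Fin.cast hfr.symm i)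
  have hv : ∀ i j, i ≠ j → v i ⬝ᵥ Pq *ᵥ v j = 0 := by
    intro i j hij
    have := @hv0 (Fin.cast hfr.symm i) (Fin.cast hfr.symm j) (by simpa using hij)
    simpa [B, Matrix.toBilin'_apply', Function.onFun] using this
  have hvn : ∀ i, v i ≠ 0 := fun i => v0.ne_zero _
  obtain ⟨N, hN⟩ := IsLocalization.exist_integer_multiples_of_finite (nonZeroDivisors ℤ)
    (fun p : Fin n × Fin n => v p.1 p.2)
  have hN0 : ((N : ℤ) : ℚ) ≠ 0 := by
    exact_mod_cast nonZeroDivisors.ne_zero N.2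
  choose w hw using hN
  have hw' : ∀ i j, ((w (i, j) : ℤ) : ℚ) = (N : ℤ) * v i j := by
    intro i j
    have := hw (i, j)
    simpa using this
  have hcol : ∀ i, (fun j => ((w (i,j) : ℤ) : ℚ)) = ((N : ℤ) : ℚ) • v i := by
    intro i; ext j; simp [hw']
  have hcast : ∀ x y : Fin n → ℤ, ((x ⬝ᵥ P *ᵥ y : ℤ) : ℚ) =
      (fun j => (x j : ℚ)) ⬝ᵥ Pq *ᵥ (fun j => (y j : ℚ)) := by
    intro x y
    simp [dotProduct, mulVec, Pq]
  have hent : ∀ i j, ((of (fun a b => w (b, a)))ᵀ * P * (of (fun a b => w (b, a)))) i j =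
      (fun k => w (i, k)) ⬝ᵥ P *ᵥ (fun k => w (j, k)) := by
    intro i j
    rw [Matrix.mul_assoc, Matrix.mul_apply]
    rfl
  have hp : ∀ i, 0 < (fun k => w (i, k)) ⬝ᵥ P *ᵥ (fun k => w (i, k)) := by
    intro i
    apply hpos
    intro h
    apply hvn i
    have h2 := hcol i
    have : (fun j => ((w (i,j) : ℤ) : ℚ)) = 0 := by
      ext j; have := congrFun h j; simp at this; simp [this]
    rw [this] at h2
    exact (smul_eq_zero.1 h2.symm).resolve_left hN0
  refine ⟨of (fun a b => w (b, a)), fun i => ((fun k => w (i, k)) ⬝ᵥ P *ᵥ (fun k => w (i, k))).toNat,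
    fun i => Int.lt_toNat.2 (hp i), ?_⟩
  ext i j
  rw [hent]
  by_cases hij : i = j
  · subst hij
    rw [Matrix.diagonal_apply_eq]
    exact (Int.toNat_of_nonneg (hp i).le).symm
  · rw [Matrix.diagonal_apply_ne _ hij]
    have := hcast (fun k => w (i, k)) (fun k => w (j, k))
    simp only [hcol] at this
    rw [Matrix.mulVec_smul, dotProduct_smul, smul_dotProduct, hv i j hij] at this
    simpa using this

lemma diag_exists {n : ℕ} (P : Matrix (Fin n) (Fin n) ℤ) (hsymm : P.IsSymm)
    (hpos : ∀ x : Fin n → ℤ, x ≠ 0 → 0 < x ⬝ᵥ P *ᵥ x) (hdet : P.det = 1) :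
    ∃ (s : (Fin n → ℤ) →+ (Fin n → ℤ)) (a : Fin n → ℕ), (∀ i, 0 < a i) ∧
      (∀ y y', ((y ⬝ᵥ P *ᵥ y' : ℤ) : ℚ) = ∑ i, (s y i : ℚ) * s y' i / a i) ∧
      (∀ k : Fin n → ℤ, (∀ y, ∃ m : ℤ, ∑ i, (k i : ℚ) * s y i / (2 * a i) = m) →
        ∃ v, k = (2:ℤ) • s v) := by
  obtain ⟨W, a, ha, hW⟩ := ortho_exists P hsymm hpos
  have ha0 : ∀ i, (a i : ℚ) ≠ 0 := fun i => by exact_mod_cast (ha i).ne'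
  let s : (Fin n → ℤ) →+ (Fin n → ℤ) := ((Wᵀ * P).mulVecLin).toAddMonoidHom
  have hs : ∀ y, s y = (Wᵀ * P) *ᵥ y := fun y => rfl
  let c : Matrix (Fin n) (Fin n) ℤ → Matrix (Fin n) (Fin n) ℚ := fun M => M.map (Int.castRingHom ℚ)
  have hWq : c (Wᵀ * P) * c W = Matrix.diagonal (fun i => (a i : ℚ)) := by
    simp only [c]
    rw [← Matrix.map_mul, hW, Matrix.diagonal_map (by simp)]
    ext i j; simp [Matrix.diagonal]
  have hinv : (Matrix.diagonal (fun i => (a i : ℚ)⁻¹) * c (Wᵀ * P)) * c W = 1 := by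
    rw [Matrix.mul_assoc, hWq, Matrix.diagonal_mul_diagonal]
    simp [ha0]
  have hinv2 := mul_eq_one_comm.1 hinv
  have hexp : ∀ y : Fin n → ℤ, ∀ j, (y j : ℚ) = ∑ i, (W j i : ℚ) * (s y i / a i) := by
    intro y j
    have h1 : c W *ᵥ ((Matrix.diagonal (fun i => (a i : ℚ)⁻¹) * c (Wᵀ * P)) *ᵥ (fun j => (y j : ℚ)))
        = (fun j => (y j : ℚ)) := by
      rw [Matrix.mulVec_mulVec, hinv2, Matrix.one_mulVec]
    have h2 := congrFun h1 j
    rw [← h2, ← Matrix.mulVec_mulVec]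
    have h3 : c (Wᵀ * P) *ᵥ (fun j => (y j : ℚ)) = fun i => (s y i : ℚ) := by
      ext i; simp [c, hs, mulVec, dotProduct]
    rw [h3]
    simp only [mulVec, dotProduct, c, Matrix.map_apply, Matrix.diagonal_apply]
    refine Finset.sum_congr rfl fun i _ => ?_
    simp [div_eq_inv_mul]
  have hsP : ∀ y i, s y i = ∑ j, W j i * (P *ᵥ y) j := by
    intro y i
    rw [hs, ← Matrix.mulVec_mulVec]; rfl
  refine ⟨s, a, ha, ?_, ?_⟩
  · intro y y'
    simp only [dotProduct]
    push_cast
    simp_rw [hexp y, Finset.sum_mul]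
    rw [Finset.sum_comm]
    refine Finset.sum_congr rfl fun i _ => ?_
    rw [hsP y' i]; push_cast
    rw [Finset.mul_sum, Finset.sum_div]
    refine Finset.sum_congr rfl fun j _ => ?_
    ring
  · intro k hk
    have hv : ∀ j, ∃ m : ℤ, ∑ i, (k i : ℚ) * W j i / (2 * a i) = m := by
      intro j
      obtain ⟨m, hm⟩ := hk (P.adjugate *ᵥ Pi.single j 1)
      refine ⟨m, ?_⟩
      rw [← hm]
      refine Finset.sum_congr rfl fun i _ => ?_
      rw [hsP, Matrix.mulVec_mulVec, Matrix.mul_adjugate, hdet, one_smul, Matrix.one_mulVec]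
      simp [Pi.single_apply]
    choose v hv using hv
    refine ⟨v, ?_⟩
    ext i
    have h4 : ((s v i : ℤ) : ℚ) = k i / 2 := by
      have h5 : (fun j => (v j : ℚ)) = c W *ᵥ (fun i => (k i : ℚ) / (2 * a i)) := by
        ext j; rw [← hv]; simp only [mulVec, dotProduct, c, Matrix.map_apply]
        refine Finset.sum_congr rfl fun i _ => ?_
        simp; ring
      have h3 : (fun i => (s v i : ℚ)) = c (Wᵀ * P) *ᵥ (fun j => (v j : ℚ)) := by
        ext i; simp [c, hs, mulVec, dotProduct]
      have := congrFun h3 i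
      rw [h5, Matrix.mulVec_mulVec, hWq, Matrix.mulVec_diagonal] at this
      rw [this]
      have := ha0 i
      field_simp
    have : (k i : ℚ) = 2 * s v i := by rw [h4]; ring
    simp
    exact_mod_cast this

section VdB
open Complex

lemma term_period (a b : ℕ) [NeZero a] (hab : a = 2 * b) (d k l : ℤ)
    (h : (k : ZMod a) = (l : ZMod a)) :
    cexp (Real.pi * I * (((k : ℂ) ^ 2 + 2 * d * k) / a)) =
      cexp (Real.pi * I * (((l : ℂ) ^ 2 + 2 * d * l) / a)) := by
  have ha : (a : ℂ) ≠ 0 := Nat.cast_ne_zero.2 (NeZero.ne a)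
  rw [ZMod.intCast_eq_intCast_iff_dvd_sub] at h
  obtain ⟨m, hm⟩ := h
  have hl : l = k + a * m := by linarith
  rw [Complex.exp_eq_exp_iff_exists_int]
  refine ⟨-(k * m + b * m ^ 2 + d * m), ?_⟩
  have hab' : (a : ℂ) = 2 * b := by rw [hab]; push_cast; ring
  have hb : (b : ℂ) ≠ 0 := by rintro h; apply ha; rw [hab', h, mul_zero]
  rw [hl]; push_cast; rw [hab']; field_simp; ring

lemma gauss_zmod (a b : ℕ) [NeZero a] (hab : a = 2 * b) (d : ℤ) :
    ∑ p : ZMod a, cexp (Real.pi * I * ((((p.val : ℤ) : ℂ) ^ 2 + 2 * d * ((p.val : ℤ) : ℂ)) / a)) =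
      ((Real.sqrt a : ℝ) : ℂ) * cexp (Real.pi * I / 4) * cexp (-(Real.pi * I * ((d : ℂ) ^ 2 / a))) := by
  have ha : (a : ℂ) ≠ 0 := Nat.cast_ne_zero.2 (NeZero.ne a)
  let F : ZMod a → ℂ := fun p => cexp (Real.pi * I * (((p.val : ℤ) : ℂ) ^ 2 / a))
  have hF : ∀ k : ℤ, F (k : ZMod a) = cexp (Real.pi * I * ((k : ℂ) ^ 2 / a)) := by
    intro k
    have := term_period a b hab 0 (((k : ZMod a).val : ℕ) : ℤ) k (by simp)
    simpa [F] using this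
  have hsum : ∑ p, F p = ((Real.sqrt a : ℝ) : ℂ) * cexp (Real.pi * I / 4) := by
    rw [← gauss_sum_fin a b hab]
    obtain ⟨m, rfl⟩ := Nat.exists_eq_succ_of_ne_zero (NeZero.ne a)
    refine Finset.sum_congr rfl fun k _ => ?_
    simp only [F]
    congr 1
    rw [mul_div_assoc]
    rfl
  have hterm : ∀ p : ZMod a,
      cexp (Real.pi * I * ((((p.val : ℤ) : ℂ) ^ 2 + 2 * d * ((p.val : ℤ) : ℂ)) / a)) =
      F (p + (d : ZMod a)) * cexp (-(Real.pi * I * ((d : ℂ) ^ 2 / a))) := by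
    intro p
    have : p + (d : ZMod a) = (((p.val : ℤ) + d : ℤ) : ZMod a) := by simp
    rw [this, hF, ← Complex.exp_add]
    congr 1; push_cast; ring
  simp_rw [hterm]
  rw [← Finset.sum_mul, ← hsum]
  congr 1
  exact Fintype.sum_equiv (Equiv.addRight (d : ZMod a)) _ _ fun p => rfl

lemma van_der_blij {n : ℕ} (P : Matrix (Fin n) (Fin n) ℤ) (hsymm : P.IsSymm)
    (hpos : ∀ x : Fin n → ℤ, x ≠ 0 → 0 < x ⬝ᵥ P *ᵥ x) (hdet : P.det = 1)
    (ξ : Fin n → ℤ) (hξ : ∀ x : Fin n → ℤ, 2 ∣ (x ⬝ᵥ P *ᵥ ξ - x ⬝ᵥ P *ᵥ x)) :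
    (8 : ℤ) ∣ n - ξ ⬝ᵥ P *ᵥ ξ := by
  classical
  obtain ⟨s, a, ha, hsP, hdual⟩ := diag_exists P hsymm hpos hdet
  have hsC : ∀ y y', ((y ⬝ᵥ P *ᵥ y' : ℤ) : ℂ) = ∑ i, (s y i : ℂ) * s y' i / a i := by
    intro y y'
    have := congrArg (fun q : ℚ => (q : ℂ)) (hsP y y')
    push_cast at this
    exact this
  have ha0 : ∀ i, (a i : ℂ) ≠ 0 := fun i => by exact_mod_cast (ha i).ne'
  have hNZ : ∀ i, NeZero (4 * a i) := fun i => ⟨by have := ha i; omega⟩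
  let f : (Fin n → ℤ) → ℂ := fun k =>
    ∏ i, cexp (Real.pi * I * (((k i : ℂ) ^ 2 + 2 * (s ξ i) * k i) / ((4 * a i : ℕ) : ℂ)))
  let h : (∀ i, ZMod (4 * a i)) → ℂ := fun p => f (fun i => ((p i).val : ℤ))
  have hf : ∀ k : Fin n → ℤ, h (fun i => (k i : ZMod (4 * a i))) = f k := by
    intro k
    refine Finset.prod_congr rfl fun i _ => ?_
    exact term_period (4 * a i) (2 * a i) (by ring) (s ξ i) _ _ (by simp)
  let ψ : (Fin n → ℤ) → (Fin n → ℤ) → ℂ := fun k y =>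
    cexp (2 * Real.pi * I * ∑ i, (k i : ℂ) * s y i / (2 * a i))
  let t : (Fin n → ℤ) → (Fin n → ℤ) := fun y => (2:ℤ) • s y
  have hfexp : ∀ k, f k = cexp (Real.pi * I * ∑ i, (((k i : ℂ) ^ 2 + 2 * (s ξ i) * k i) / (4 * a i))) := by
    intro k
    simp only [f]
    rw [← Complex.exp_sum, Finset.mul_sum]
    push_cast; rfl
  have hft : ∀ y, f (t y) = 1 := by
    intro y
    rw [hfexp, Complex.exp_eq_one_iff]
    obtain ⟨m, hm⟩ := hξ y
    refine ⟨m + y ⬝ᵥ P *ᵥ y, ?_⟩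
    have e : ∑ i, ((((t y) i : ℂ) ^ 2 + 2 * (s ξ i) * (t y) i) / (4 * a i)) =
        ((y ⬝ᵥ P *ᵥ y : ℤ) : ℂ) + ((y ⬝ᵥ P *ᵥ ξ : ℤ) : ℂ) := by
      rw [hsC, hsC, ← Finset.sum_add_distrib]
      refine Finset.sum_congr rfl fun i _ => ?_
      have := ha0 i
      simp [t]; field_simp; ring
    have : y ⬝ᵥ P *ᵥ ξ = y ⬝ᵥ P *ᵥ y + 2 * m := by linarith
    rw [e, this]; push_cast; ring
  have hftr : ∀ k y, f (k + t y) = f k * ψ k y := by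
    intro k y
    have : f (k + t y) = f k * f (t y) * ψ k y := by
      simp only [hfexp, ψ]
      rw [← Complex.exp_add, ← Complex.exp_add]
      congr 1
      simp only [Finset.mul_sum, ← Finset.sum_add_distrib]
      refine Finset.sum_congr rfl fun i _ => ?_
      have := ha0 i
      simp [t]; field_simp; ring
    rw [this, hft, mul_one]
  have hψt : ∀ k y y0, ψ (k + t y) y0 = ψ k y0 := by
    intro k y y0
    have : ψ (k + t y) y0 = ψ k y0 * cexp (2 * Real.pi * I * ((y ⬝ᵥ P *ᵥ y0 : ℤ) : ℂ)) := by
      simp only [ψ]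
      rw [← Complex.exp_add, hsC]
      congr 1
      simp only [Finset.mul_sum, ← Finset.sum_add_distrib]
      refine Finset.sum_congr rfl fun i _ => ?_
      have := ha0 i
      simp [t]; field_simp
    rw [this, Complex.exp_eq_one_iff.2 ⟨y ⬝ᵥ P *ᵥ y0, by ring⟩, mul_one]
  let ι : (Fin n → ℤ) →+ (∀ i, ZMod (4 * a i)) :=
    { toFun := fun y i => ((t y i : ℤ) : ZMod (4 * a i))
      map_zero' := by ext i; simp [t]
      map_add' := by intro x y; ext i; simp [t]; ring }
  let H := ι.range
  have : Fintype H := Fintype.ofFinite H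
  have hhι : ∀ p y, h (p + ι y) = f ((fun i => ((p i).val : ℤ)) + t y) := by
    intro p y
    rw [← hf]; congr 1; ext i; simp [ι]
  have hT : ∀ p, ∃ r : ℝ, 0 ≤ r ∧ ∑ η : H, h (p + η) = r := by
    intro p
    by_cases hp : ∀ y, ψ (fun i => ((p i).val : ℤ)) y = 1
    · refine ⟨Fintype.card H, by positivity, ?_⟩
      obtain ⟨v, hv⟩ := hdual (fun i => ((p i).val : ℤ)) (by
        intro y
        obtain ⟨m, hm⟩ := Complex.exp_eq_one_iff.1 (hp y)
        refine ⟨m, ?_⟩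
        have : (∑ i, ((((p i).val : ℤ)) : ℂ) * s y i / (2 * a i)) = m := by
          have h2 : (2 * Real.pi * I : ℂ) ≠ 0 := by simp [Real.pi_ne_zero]
          apply mul_left_cancel₀ h2
          rw [hm]; ring
        have h3 : ((∑ i, ((((p i).val : ℤ)) : ℚ) * s y i / (2 * a i) : ℚ) : ℂ) = ((m : ℚ) : ℂ) := by
          push_cast; push_cast at this; exact this
        exact_mod_cast h3)
      have : ∀ η : H, h (p + η) = 1 := by
        rintro ⟨_, y, rfl⟩
        rw [hhι, hv]
        have : (2:ℤ) • s v + t y = t (v + y) := by simp only [t, map_add, smul_add]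
        rw [this, hft]
      simp [this]
    · push Not at hp
      obtain ⟨y0, hy0⟩ := hp
      refine ⟨0, le_rfl, ?_⟩
      have e1 : ∑ η : H, h (p + η) = ∑ η : H, h (p + η) * ψ (fun i => ((p i).val : ℤ)) y0 := by
        rw [← Equiv.sum_comp (Equiv.addRight (⟨ι y0, y0, rfl⟩ : H))]
        refine Finset.sum_congr rfl fun η _ => ?_
        obtain ⟨_, y, rfl⟩ := η
        have : p + ((Equiv.addRight (⟨ι y0, y0, rfl⟩ : H)) ⟨ι y, y, rfl⟩ : H) = p + ι (y + y0) := by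
          simp
        rw [this, hhι]
        have h5 : t (y + y0) = t y + t y0 := by simp only [t, map_add, smul_add]
        rw [h5, ← add_assoc, hftr, hψt, hhι]
      rw [← Finset.sum_mul] at e1
      have : (∑ η : H, h (p + η)) * (ψ (fun i => ((p i).val : ℤ)) y0 - 1) = 0 := by
        rw [mul_sub, ← e1]; ring
      rcases mul_eq_zero.1 this with h0 | h0
      · simpa using h0
      · exact absurd (sub_eq_zero.1 h0) hy0
  have hS : ∃ r : ℝ, 0 ≤ r ∧ ∑ p, h p = r := by
    choose r hr0 hr using hT
    have hc : (0:ℝ) < Fintype.card H := by exact_mod_cast Fintype.card_pos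
    refine ⟨(∑ p, r p) / Fintype.card H, div_nonneg (Finset.sum_nonneg fun p _ => hr0 p) hc.le, ?_⟩
    have e : (Fintype.card H : ℂ) * ∑ p, h p = ∑ p, (r p : ℂ) := by
      simp_rw [← hr]
      rw [Finset.sum_comm]
      have : ∀ η : H, ∑ p, h (p + η) = ∑ p, h p := fun η =>
        Fintype.sum_equiv (Equiv.addRight (η : ∀ i, ZMod (4 * a i))) _ _ fun p => rfl
      simp [this]
    have hc' : (Fintype.card H : ℂ) ≠ 0 := by exact_mod_cast hc.ne'
    push_cast
    rw [eq_div_iff hc', ← e]; ring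
  have hprod : ∑ p, h p = ((∏ i, Real.sqrt ((4 * a i : ℕ) : ℝ) : ℝ) : ℂ) *
      cexp (Real.pi * I / 4 * ((n : ℂ) - ((ξ ⬝ᵥ P *ᵥ ξ : ℤ) : ℂ))) := by
    have e1 : ∑ p, h p = ∏ i, ∑ q : ZMod (4 * a i), cexp (Real.pi * I *
        ((((q.val : ℤ) : ℂ) ^ 2 + 2 * (s ξ i : ℤ) * ((q.val : ℤ) : ℂ)) / ((4 * a i : ℕ) : ℂ))) := by
      rw [Finset.prod_univ_sum, Fintype.piFinset_univ]
    rw [e1]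
    have e2 := fun i => gauss_zmod (4 * a i) (2 * a i) (by ring) (s ξ i)
    simp_rw [e2]
    rw [Finset.prod_mul_distrib, Finset.prod_mul_distrib, ← Complex.exp_sum, ← Complex.exp_sum,
      mul_assoc, ← Complex.exp_add, hsC]
    congr 1
    · push_cast; rfl
    · congr 1
      have e3 : ∑ i, -(Real.pi * I * ((s ξ i : ℂ) ^ 2 / ((4 * a i : ℕ) : ℂ))) =
          -(Real.pi * I / 4) * ∑ i, (s ξ i : ℂ) * s ξ i / a i := by
        rw [Finset.mul_sum]
        refine Finset.sum_congr rfl fun i _ => ?_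
        push_cast; ring
      rw [e3]
      simp only [Finset.sum_const, Finset.card_univ, Fintype.card_fin, nsmul_eq_mul]
      ring
  obtain ⟨r, hr0, hr⟩ := hS
  rw [hr] at hprod
  set R : ℝ := ∏ i, Real.sqrt ((4 * a i : ℕ) : ℝ) with hR
  have hRpos : 0 < R := Finset.prod_pos fun i _ => Real.sqrt_pos.2 (by
    have := ha i
    exact_mod_cast (by omega : 0 < 4 * a i))
  set m : ℤ := (n : ℤ) - ξ ⬝ᵥ P *ᵥ ξ with hm
  have hmC : ((n : ℂ) - ((ξ ⬝ᵥ P *ᵥ ξ : ℤ) : ℂ)) = (m : ℂ) := by rw [hm]; push_cast; ring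
  rw [hmC] at hprod
  have harg : (Real.pi * I / 4 * (m : ℂ)) = ((Real.pi / 4 * m : ℝ) : ℂ) * I := by push_cast; ring
  have hn := congrArg norm hprod
  rw [harg, norm_mul, Complex.norm_exp_ofReal_mul_I, mul_one, Complex.norm_real, Complex.norm_real,
    Real.norm_of_nonneg hr0, Real.norm_of_nonneg hRpos.le] at hn
  rw [hn] at hprod
  have hR0 : (R : ℂ) ≠ 0 := by exact_mod_cast hRpos.ne'
  have h1 : cexp (Real.pi * I / 4 * (m : ℂ)) = 1 := by
    apply mul_left_cancel₀ hR0
    rw [← hprod, mul_one]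
  obtain ⟨q, hq⟩ := Complex.exp_eq_one_iff.1 h1
  refine ⟨q, ?_⟩
  have h2 : (Real.pi * I : ℂ) ≠ 0 := by simp [Real.pi_ne_zero]
  have : (m : ℂ) = 8 * q := by
    apply mul_left_cancel₀ h2
    linear_combination 4 * hq
  exact_mod_cast this

end VdB

lemma dvd_of_pairing {n : ℕ} (P : Matrix (Fin n) (Fin n) ℤ) (hsymm : P.IsSymm) (hdet : P.det = 1)
    (u : Fin n → ℤ) (h : ∀ x, (2:ℤ) ∣ x ⬝ᵥ P *ᵥ u) : ∃ z, u = (2:ℤ) • z := by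
  have : ∀ j, ∃ c, u j = 2 * c := by
    intro j
    have := h (P.adjugate *ᵥ Pi.single j 1)
    rw [Matrix.dotProduct_mulVec, ← Matrix.mulVec_transpose, hsymm, Matrix.mulVec_mulVec,
      Matrix.mul_adjugate, hdet, one_smul, Matrix.one_mulVec, single_one_dotProduct] at this
    exact this
  choose z hz using this
  exact ⟨z, by ext j; simp [hz]⟩

/-- Let `L = ℤⁿ` (Gram matrix `P`) be an exceptional odd unimodular lattice with
`n ≡ 2, 3 or 4 (mod 8)` and no vector of norm 1. Then `W(L)^±` acts transitively on
`Exc L`, the set of characteristic vectors of norm `< 8`. -/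
theorem weylPM_transitive_on_exceptional_vectors
    {n : ℕ} (P : Matrix (Fin n) (Fin n) ℤ) (hsymm : P.IsSymm)
    (hpos : ∀ x : Fin n → ℤ, x ≠ 0 → 0 < x ⬝ᵥ P *ᵥ x) (hdet : P.det = 1)
    (hodd : ∃ x : Fin n → ℤ, ¬ Even (x ⬝ᵥ P *ᵥ x))
    (hmod : n % 8 = 2 ∨ n % 8 = 3 ∨ n % 8 = 4)
    (hno1 : ∀ x : Fin n → ℤ, x ⬝ᵥ P *ᵥ x ≠ 1)
    (hexc : ∃ ξ : Fin n → ℤ, (∀ x : Fin n → ℤ, 2 ∣ (x ⬝ᵥ P *ᵥ ξ - x ⬝ᵥ P *ᵥ x)) ∧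
      ξ ⬝ᵥ P *ᵥ ξ < 8) :
    ∀ v v' : Fin n → ℤ,
      (∀ x : Fin n → ℤ, 2 ∣ (x ⬝ᵥ P *ᵥ v - x ⬝ᵥ P *ᵥ x)) → v ⬝ᵥ P *ᵥ v < 8 →
      (∀ x : Fin n → ℤ, 2 ∣ (x ⬝ᵥ P *ᵥ v' - x ⬝ᵥ P *ᵥ x)) → v' ⬝ᵥ P *ᵥ v' < 8 →
      ∃ σ ∈ weylPM P, σ v = v' := by
  intro v v' hv hv8 hv' hv8'
  have hnn : ∀ x : Fin n → ℤ, 0 ≤ x ⬝ᵥ P *ᵥ x := by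
    intro x
    by_cases h : x = 0
    · simp [h]
    · exact (hpos x h).le
  have hzero : ∀ x : Fin n → ℤ, x ⬝ᵥ P *ᵥ x = 0 → x = 0 := by
    intro x hx
    by_contra h
    exact (hpos x h).ne' hx
  have hcomm : ∀ x y : Fin n → ℤ, x ⬝ᵥ P *ᵥ y = y ⬝ᵥ P *ᵥ x := by
    intro x y
    rw [Matrix.dotProduct_mulVec, ← Matrix.mulVec_transpose, hsymm, dotProduct_comm]
  have b1 := van_der_blij P hsymm hpos hdet v hv
  have b2 := van_der_blij P hsymm hpos hdet v' hv'
  have p1 := hnn v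
  have p2 := hnn v'
  obtain ⟨x, hx⟩ := dvd_of_pairing P hsymm hdet (v - v') (by
    intro x
    have := dvd_sub (hv x) (hv' x)
    rw [Matrix.mulVec_sub, dotProduct_sub]
    have e : x ⬝ᵥ P *ᵥ v - x ⬝ᵥ P *ᵥ v' =
      x ⬝ᵥ P *ᵥ v - x ⬝ᵥ P *ᵥ x - (x ⬝ᵥ P *ᵥ v' - x ⬝ᵥ P *ᵥ x) := by ring
    rw [e]; exact this)
  obtain ⟨y, rfl⟩ : ∃ y, v' = y - x := ⟨v' + x, by simp⟩
  obtain rfl : v = y + x := by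
    have : v = (2:ℤ) • x + (y - x) := by rw [← hx]; simp
    rw [this, two_smul]; abel
  clear hx
  have q1 : (y + x) ⬝ᵥ P *ᵥ (y + x) = y ⬝ᵥ P *ᵥ y + 2 * (x ⬝ᵥ P *ᵥ y) + x ⬝ᵥ P *ᵥ x := by
    simp only [Matrix.mulVec_add, dotProduct_add, add_dotProduct]
    rw [hcomm y x]; ring
  have q2 : (y - x) ⬝ᵥ P *ᵥ (y - x) = y ⬝ᵥ P *ᵥ y - 2 * (x ⬝ᵥ P *ᵥ y) + x ⬝ᵥ P *ᵥ x := by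
    simp only [Matrix.mulVec_sub, dotProduct_sub, sub_dotProduct]
    rw [hcomm y x]; ring
  have nx := hnn x
  have ny := hnn y
  have ox := hno1 x
  have oy := hno1 y
  have hxy : x ⬝ᵥ P *ᵥ y = 0 := by omega
  rcases (by omega : x ⬝ᵥ P *ᵥ x = 0 ∨ y ⬝ᵥ P *ᵥ y = 0 ∨ x ⬝ᵥ P *ᵥ x = 2) with h | h | h
  · rw [hzero x h]
    exact ⟨1, one_mem _, by simp⟩
  · rw [hzero y h]
    refine ⟨LinearEquiv.neg ℤ, Subgroup.subset_closure (Or.inr fun z => by simp), by simp⟩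
  · let s : (Fin n → ℤ) →ₗ[ℤ] (Fin n → ℤ) :=
      { toFun := fun z => z - (z ⬝ᵥ P *ᵥ x) • x
        map_add' := by intro z w; rw [add_dotProduct, add_smul]; abel
        map_smul' := by intro c z; rw [smul_dotProduct, smul_sub, smul_assoc]; rfl }
    have hs : ∀ z, s z = z - (z ⬝ᵥ P *ᵥ x) • x := fun z => rfl
    have hss : s ∘ₗ s = LinearMap.id := by
      ext1 z
      ext j
      simp only [LinearMap.comp_apply, hs, sub_dotProduct, smul_dotProduct, h, LinearMap.id_apply,
        Pi.sub_apply, Pi.smul_apply, smul_eq_mul]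
      ring
    refine ⟨LinearEquiv.ofLinearMap s s hss hss, Subgroup.subset_closure (Or.inl ⟨x, h, hs⟩), ?_⟩
    change s (y + x) = y - x
    rw [hs, add_dotProduct, hcomm y x, hxy, h, zero_add, two_smul]
    abel
end

section
/- Let L be a unimodular integral lattice of rank 8k + r with 0 ≤ r < 8 and containing no vector of norm 1, and let s ≥ 0 be an integer. Then the orthogonal direct sum L ⊥ I_s (where I_s = ℤ^s with the standard inner product) is exceptional if and only if L is exceptional and r + s < 8. -/
open Matrix

/-- A lattice (given by its Gram matrix) is exceptional if it has a characteristic vector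
of norm `< 8`. -/
def IsExceptional {ι : Type} [Fintype ι] (P : Matrix ι ι ℤ) : Prop :=
  ∃ ξ : ι → ℤ, (∀ x : ι → ℤ, 2 ∣ (x ⬝ᵥ P *ᵥ ξ - x ⬝ᵥ P *ᵥ x)) ∧ ξ ⬝ᵥ P *ᵥ ξ < 8


open Complex MeasureTheory Filter Topology in
lemma vdb_fourier (g : ℝ → ℂ) (hg : ContDiff ℝ 2 g) (h01 : g 0 = g 1) :
    HasSum (fun m : ℤ => ∫ x in (0:ℝ)..1, cexp (-(2 * Real.pi * I * m * x)) * g x) (g 0) := by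
  have hF : Fact ((0:ℝ) < 1) := ⟨zero_lt_one⟩
  have hd1 : ∀ x, HasDerivAt g (deriv g x) x := fun x =>
    (hg.differentiable (by norm_num) x).hasDerivAt
  have hg1 : ContDiff ℝ 1 (deriv g) := hg.deriv' 
  have hd2 : ∀ x, HasDerivAt (deriv g) (deriv (deriv g) x) x := fun x =>
    (hg1.differentiable (by norm_num) x).hasDerivAt
  have hc1 : Continuous (deriv g) := hg1.continuous
  have hc2 : Continuous (deriv (deriv g)) := (hg1.deriv' (n := 0)).continuous
  let B : C(AddCircle (1:ℝ), ℂ) := ⟨AddCircle.liftIco 1 0 g,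
    AddCircle.liftIco_zero_continuous h01 hg.continuous.continuousOn⟩
  have hco : ∀ m : ℤ, fourierCoeff B m = fourierCoeffOn zero_lt_one g m := by
    intro m
    have := fourierCoeff_liftIco_eq (T := 1) (a := 0) g m
    simp only [zero_add] at this
    exact this
  have hint : ∀ (f : ℝ → ℂ) (m : ℤ), fourierCoeffOn zero_lt_one f m =
      ∫ x in (0:ℝ)..1, cexp (-(2 * Real.pi * I * m * x)) * f x := by
    intro f m
    rw [fourierCoeffOn_eq_integral]
    simp only [sub_zero, div_one, one_smul, smul_eq_mul]
    refine intervalIntegral.integral_congr fun x _ => ?_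
    congr 1
    have := @fourier_coe_apply (1 - 0) (-m) x
    simp only [sub_zero] at this ⊢
    rw [this]
    congr 1
    push_cast
    ring
  obtain ⟨M, hM⟩ : ∃ M : ℝ, ∀ m : ℤ, ‖fourierCoeffOn zero_lt_one (deriv (deriv g)) m‖ ≤ M := by
    refine ⟨∫ x in (0:ℝ)..1, ‖deriv (deriv g) x‖, fun m => ?_⟩
    rw [hint]
    refine (intervalIntegral.norm_integral_le_integral_norm zero_le_one).trans (le_of_eq ?_)
    refine intervalIntegral.integral_congr fun x _ => ?_
    simp only [norm_mul]
    rw [show -(2 * (Real.pi:ℂ) * I * m * x) = ((-(2 * Real.pi * m * x) : ℝ) : ℂ) * I by push_cast; ring,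
      norm_exp_ofReal_mul_I, one_mul]
  have key : ∀ m : ℤ, m ≠ 0 → fourierCoeffOn zero_lt_one g m =
     (1 / (-2 * Real.pi * I))^2 * (1 / (m:ℂ)^2) * (-((deriv g 1 - deriv g 0) - fourierCoeffOn zero_lt_one (deriv (deriv g)) m)) := by
    intro m hm
    rw [fourierCoeffOn_of_hasDerivAt zero_lt_one hm (fun x _ => hd1 x) (hc1.intervalIntegrable _ _),
      fourierCoeffOn_of_hasDerivAt zero_lt_one hm (fun x _ => hd2 x) (hc2.intervalIntegrable _ _)]
    rw [QuotientAddGroup.mk_zero, fourier_eval_zero, h01]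
    have : (m:ℂ) ≠ 0 := by exact_mod_cast hm
    have hpi : (Real.pi:ℂ) ≠ 0 := by exact_mod_cast Real.pi_ne_zero
    push_cast
    field_simp
    ring
  have hsum : Summable (fourierCoeff B) := by
    have h2 : Summable (fun m : ℤ => ‖(1 / (-2 * Real.pi * I) : ℂ)^2‖ * (‖deriv g 1 - deriv g 0‖ + M) * (1 / (m:ℝ)^2)) :=
      (Real.summable_one_div_int_pow.mpr (by norm_num)).mul_left _
    refine Summable.of_norm_bounded_eventually h2 ?_
    have : ({0}ᶜ : Set ℤ) ∈ (cofinite : Filter ℤ) := (Set.finite_singleton 0).compl_mem_cofinite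
    filter_upwards [this] with m hm
    rw [hco, key m hm, norm_mul, norm_mul, norm_neg, mul_right_comm]
    have e : ‖1 / (m:ℂ)^2‖ = 1 / (m:ℝ)^2 := by simp
    rw [e]
    gcongr
    exact (norm_sub_le _ _).trans (by gcongr; exact hM m)
  have := has_pointwise_sum_fourier_series_of_summable hsum 0
  simp only [fourier_eval_zero, smul_eq_mul, mul_one] at this
  have hB : B 0 = g 0 := AddCircle.liftIco_coe_apply (p := (1:ℝ)) (a := 0) (x := 0) (f := g) (by simp)
  rw [hB] at this
  refine this.congr_fun ?_ |> id
  intro m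
  rw [hco, hint]

open Complex MeasureTheory Filter Topology in
lemma vdb_fresnel : ∃ C : ℂ, Tendsto (fun B : ℝ => ∫ y in (0:ℝ)..B, cexp (Real.pi * I * y ^ 2)) atTop (𝓝 C) := by
  let E : ℝ → ℂ := fun y => cexp (Real.pi * I * y ^ 2)
  have hn : ∀ y, ‖E y‖ = 1 := by
    intro y
    simp only [E]
    rw [show (Real.pi:ℂ) * I * y ^ 2 = ((Real.pi * y^2 : ℝ) : ℂ) * I by push_cast; ring, norm_exp_ofReal_mul_I]
  have hEc : Continuous E := by fun_prop
  let G : ℝ → ℂ := fun y => E y * (1 / (2 * Real.pi * I) * (1 / (y:ℂ)))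
  let K : ℝ → ℂ := fun y => E y * (1 / (2 * Real.pi * I) * (1 / (y:ℂ)^2))
  have hpi : (Real.pi:ℂ) ≠ 0 := by exact_mod_cast Real.pi_ne_zero
  have hG : ∀ y : ℝ, 0 < y → HasDerivAt G (E y - K y) y := by
    intro y hy
    have hy' : (y:ℂ) ≠ 0 := by exact_mod_cast hy.ne'
    have h1 : HasDerivAt (fun y : ℝ => (y:ℂ)) 1 y := Complex.ofRealCLM.hasDerivAt (x := y)
    have h2 := ((h1.pow 2).const_mul (Real.pi * I : ℂ)).cexp
    have h3 := h2.mul ((h1.inv hy').const_mul (1 / (2 * Real.pi * I) : ℂ))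
    convert! h3 using 1
    · ext z; simp [G, E]
    · simp only [E, K]
      simp
      field_simp
      ring_nf
      rw [I_sq]
      ring
  have hKc : ContinuousOn K (Set.Ici 1) := by
    refine hEc.continuousOn.mul (continuousOn_const.mul ?_)
    refine ContinuousOn.div continuousOn_const (by fun_prop) ?_
    intro y hy
    have : (0:ℝ) < y := lt_of_lt_of_le one_pos hy
    exact pow_ne_zero _ (by exact_mod_cast this.ne')
  have hKi : IntegrableOn K (Set.Ioi 1) := by
    have h := (integrableOn_Ioi_rpow_of_lt (a := -2) (by norm_num) (one_pos : (0:ℝ) < 1)).const_mul (‖(1 / (2 * Real.pi * I) : ℂ)‖)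
    refine Integrable.mono' h ((hKc.mono Set.Ioi_subset_Ici_self).aestronglyMeasurable measurableSet_Ioi) ?_
    filter_upwards [ae_restrict_mem measurableSet_Ioi] with y hy
    have hy0 : (0:ℝ) < y := lt_trans one_pos hy
    simp only [K, norm_mul, hn, one_mul]
    gcongr
    rw [Real.rpow_neg hy0.le]
    simp
  have hGt : Tendsto G atTop (𝓝 0) := by
    rw [tendsto_zero_iff_norm_tendsto_zero]
    have : Tendsto (fun y : ℝ => ‖(1 / (2 * Real.pi * I) : ℂ)‖ * |y⁻¹|) atTop (𝓝 0) := by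
      have := (tendsto_inv_atTop_zero (𝕜 := ℝ)).abs.const_mul ‖(1 / (2 * Real.pi * I) : ℂ)‖
      simpa using this
    refine this.congr fun y => ?_
    simp only [G, norm_mul, hn, one_mul]
    simp
  have hIt := intervalIntegral_tendsto_integral_Ioi 1 hKi tendsto_id
  refine ⟨(∫ y in (0:ℝ)..1, E y) + ((0 - G 1) + ∫ y in Set.Ioi 1, K y), ?_⟩
  have := ((hGt.sub_const (G 1)).add hIt).const_add (∫ y in (0:ℝ)..1, E y)
  refine this.congr' ?_
  filter_upwards [eventually_ge_atTop 1] with B hB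
  have hsub : Set.uIcc 1 B ⊆ Set.Ici 1 := by rw [Set.uIcc_of_le hB]; exact Set.Icc_subset_Ici_self
  have hKint : IntervalIntegrable K volume 1 B := (hKc.mono hsub).intervalIntegrable
  have h1 := intervalIntegral.integral_eq_sub_of_hasDerivAt (a := 1) (b := B) (f := G) (f' := fun y => E y - K y)
    (fun y hy => hG y (lt_of_lt_of_le one_pos (hsub hy))) ((hEc.intervalIntegrable _ _).sub hKint)
  rw [intervalIntegral.integral_sub (hEc.intervalIntegrable _ _) hKint] at h1
  rw [← h1, id, sub_add_cancel, intervalIntegral.integral_add_adjacent_intervals (hEc.intervalIntegrable _ _) (hEc.intervalIntegrable _ _)]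

open Complex MeasureTheory Filter Topology in
lemma vdb_fresnel2 : ∃ C : ℂ, ∀ (u v : ℕ → ℝ), Tendsto u atTop atBot → Tendsto v atTop atTop →
    Tendsto (fun N => ∫ y in (u N)..(v N), cexp (Real.pi * I * y ^ 2)) atTop (𝓝 C) := by
  obtain ⟨C, hC⟩ := vdb_fresnel
  refine ⟨C + C, fun u v hu hv => ?_⟩
  have h1 := hC.comp (tendsto_neg_atBot_atTop.comp hu)
  have h2 := hC.comp hv
  refine (h1.add h2).congr fun N => ?_
  have hEc : Continuous (fun y : ℝ => cexp (Real.pi * I * y ^ 2)) := by fun_prop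
  rw [← intervalIntegral.integral_add_adjacent_intervals (hEc.intervalIntegrable (u N) 0) (hEc.intervalIntegrable 0 (v N))]
  congr 1
  have := intervalIntegral.integral_comp_neg (a := u N) (b := 0) (fun y : ℝ => cexp (Real.pi * I * y ^ 2))
  simp only [neg_zero] at this
  simp only [Function.comp]
  rw [← this]
  simp

open Complex MeasureTheory Filter Topology in
lemma vdb_gauss0 : ∃ C : ℂ, ∀ (a : ℕ) (w : ℤ), 0 < a → Even ((a:ℤ) + w) →
    ∑ t ∈ Finset.range a, cexp (Real.pi * I * ((t:ℂ) ^ 2 + t * w) / a) =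
      cexp (-(Real.pi * I * (w:ℂ)^2 / (4 * a))) * (Real.sqrt a * C) := by
  obtain ⟨C, hC⟩ := vdb_fresnel2
  refine ⟨C, fun a w ha hw => ?_⟩
  have ha0 : (a:ℂ) ≠ 0 := by exact_mod_cast ha.ne'
  have haR : (0:ℝ) < a := by exact_mod_cast ha
  obtain ⟨q, hq⟩ := hw
  have hqC : (w:ℂ) = 2 * q - a := by
    have : ((a:ℂ) + w) = q + q := by exact_mod_cast hq
    linear_combination this
  let h : ℝ → ℂ := fun x => cexp (Real.pi * I * ((x:ℂ) ^ 2 + x * w) / a)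
  let E1 : ℝ → ℂ := fun x => cexp (Real.pi * I * (x:ℂ) ^ 2 / a)
  let K : ℂ := cexp (-(Real.pi * I * (w:ℂ)^2 / (4 * a)))
  have hE1c : Continuous E1 := by fun_prop
  let g : ℝ → ℂ := fun u => ∑ t ∈ Finset.range a, h (u + t)
  have hcd : ContDiff ℝ 2 h := by
    have : ContDiff ℝ 2 (fun x : ℝ => (x:ℂ)) := Complex.ofRealCLM.contDiff
    exact (((contDiff_const.mul ((this.pow 2).add (this.mul contDiff_const))).div_const _)).cexp
  have hg : ContDiff ℝ 2 g := by
    refine ContDiff.sum fun t _ => hcd.comp (contDiff_id.add contDiff_const)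
  have hper : h a = h 0 := by
    simp only [h]
    rw [exp_eq_exp_iff_exists_int]
    refine ⟨q, ?_⟩
    push_cast
    rw [hqC]
    field_simp
    ring
  have h01 : g 0 = g 1 := by
    have h1 := Finset.sum_range_succ (fun t : ℕ => h t) a
    have h2 := Finset.sum_range_succ' (fun t : ℕ => h t) a
    simp only [g]
    rw [h1] at h2
    simp only [Nat.cast_zero, hper] at h2
    have h3 := add_right_cancel h2
    simp only [zero_add]
    rw [h3]
    refine Finset.sum_congr rfl fun t _ => ?_
    push_cast
    rw [add_comm]
  have hF := vdb_fourier g hg h01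
  have hcoef : ∀ m : ℤ, (∫ x in (0:ℝ)..1, cexp (-(2 * Real.pi * I * m * x)) * g x) =
      K * ∫ x in ((w:ℝ)/2 - a * m)..((w:ℝ)/2 - a * m + a), E1 x := by
    intro m
    let H : ℝ → ℂ := fun x => K * E1 (x + ((w:ℝ)/2 - a * m))
    have hHc : Continuous H := by fun_prop
    have e1 : ∀ x : ℝ, cexp (-(2 * Real.pi * I * m * x)) * g x = ∑ t ∈ Finset.range a, H (x + t) := by
      intro x
      simp only [g, Finset.mul_sum]
      refine Finset.sum_congr rfl fun t _ => ?_
      simp only [H, h, K, E1]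
      rw [← Complex.exp_add, ← Complex.exp_add, exp_eq_exp_iff_exists_int]
      obtain ⟨r, hr⟩ : ∃ r : ℤ, m * (m - 1) = r + r := by
        obtain ⟨r, hr⟩ := Int.even_mul_pred_self m
        exact ⟨r, hr⟩
      have hrC : (m:ℂ) * (m - 1) = r + r := by exact_mod_cast hr
      refine ⟨m * t + m * q - a * m - a * r, ?_⟩
      push_cast
      have : (r:ℂ) = m * (m-1) / 2 := by rw [hrC]; ring
      rw [this, hqC]
      field_simp
      ring
    simp_rw [e1]
    rw [intervalIntegral.integral_finsetSum (fun t _ => Continuous.intervalIntegrable (by fun_prop) _ _)]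
    have e2 : ∀ t : ℕ, (∫ x in (0:ℝ)..1, H (x + t)) = ∫ x in (t:ℝ)..((t+1 : ℕ):ℝ), H x := by
      intro t
      rw [intervalIntegral.integral_comp_add_right (fun x => H x)]
      push_cast
      rw [zero_add, add_comm]
    simp_rw [e2]
    rw [intervalIntegral.sum_integral_adjacent_intervals (a := fun k : ℕ => (k:ℝ)) (fun k _ => hHc.intervalIntegrable _ _)]
    simp only [H, intervalIntegral.integral_const_mul]
    rw [intervalIntegral.integral_comp_add_right (fun x => E1 x)]
    congr 2
    · simp
    · ring
  simp_rw [hcoef] at hF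
  have hT := (HasSum.nat_add_neg_add_one hF).tendsto_sum_nat
  have hpart : ∀ N : ℕ, ∑ n ∈ Finset.range N, (K * (∫ x in ((w:ℝ)/2 - a * ((n:ℤ):ℝ))..((w:ℝ)/2 - a * ((n:ℤ):ℝ) + a), E1 x) +
      K * (∫ x in ((w:ℝ)/2 - a * ((-((n:ℤ)+1) : ℤ):ℝ))..((w:ℝ)/2 - a * ((-((n:ℤ)+1) : ℤ):ℝ) + a), E1 x)) =
      K * ∫ x in ((w:ℝ)/2 + a - a * N)..((w:ℝ)/2 + a + a * N), E1 x := by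
    intro N
    induction N with
    | zero => simp
    | succ N ih =>
      rw [Finset.sum_range_succ, ih]
      have hi := fun x y => hE1c.intervalIntegrable (μ := volume) x y
      rw [← intervalIntegral.integral_add_adjacent_intervals (hi ((w:ℝ)/2 + a - a * ((N+1:ℕ):ℝ)) ((w:ℝ)/2 + a - a * N)) (hi _ _),
        ← intervalIntegral.integral_add_adjacent_intervals (hi ((w:ℝ)/2 + a - a * (N:ℝ)) ((w:ℝ)/2 + a + a * N)) (hi _ ((w:ℝ)/2 + a + a * ((N+1:ℕ):ℝ)))]
      push_cast
      rw [show (w:ℝ)/2 + a - a * ((N:ℝ)+1) = (w:ℝ)/2 - a * N by ring,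
        show (w:ℝ)/2 - a * N + a = (w:ℝ)/2 + a - a * N by ring,
        show (w:ℝ)/2 - a * (-((N:ℝ)+1)) = (w:ℝ)/2 + a + a * N by ring,
        show (w:ℝ)/2 + a + a * N + a = (w:ℝ)/2 + a + a * (N+1) by ring]
      ring
  simp_rw [hpart] at hT
  have hscale : ∀ A B : ℝ, ∫ x in A..B, E1 x = Real.sqrt a * ∫ y in (A / Real.sqrt a)..(B / Real.sqrt a), cexp (Real.pi * I * y ^ 2) := by
    intro A B
    have hs : Real.sqrt a ≠ 0 := (Real.sqrt_pos.mpr haR).ne'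
    have := intervalIntegral.integral_comp_div (a := A) (b := B) (fun y : ℝ => cexp (Real.pi * I * y ^ 2)) hs
    rw [Complex.real_smul] at this
    rw [← this]
    refine intervalIntegral.integral_congr fun x _ => ?_
    simp only [E1]
    congr 1
    have h2 : ((Real.sqrt a : ℝ) : ℂ)^2 = a := by
      rw [← Complex.ofReal_pow, Real.sq_sqrt haR.le]; simp
    push_cast
    rw [div_pow, h2]
    ring
  simp_rw [hscale] at hT
  have hs : 0 < Real.sqrt a := Real.sqrt_pos.mpr haR
  have hN : Tendsto (fun N : ℕ => (a:ℝ) * N) atTop atTop := tendsto_natCast_atTop_atTop.const_mul_atTop haR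
  have hT2 := hC (fun N : ℕ => ((w:ℝ)/2 + a - a * N) / Real.sqrt a) (fun N : ℕ => ((w:ℝ)/2 + a + a * N) / Real.sqrt a)
    (by
      refine Tendsto.atBot_div_const hs ?_
      simp_rw [sub_eq_add_neg]
      exact tendsto_atBot_add_const_left _ _ (tendsto_neg_atTop_atBot.comp hN))
    (by
      refine Tendsto.atTop_div_const hs ?_
      exact tendsto_atTop_add_const_left _ _ hN)
  have hT3 := (hT2.const_mul (Real.sqrt a : ℂ)).const_mul K
  have := tendsto_nhds_unique hT hT3
  rw [← this]
  simp only [g, h, zero_add]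
  simp

open Complex in
lemma vdb_gauss (a : ℕ) (w : ℤ) (ha : 0 < a) (hw : Even ((a:ℤ) + w)) :
    ∑ t ∈ Finset.range a, cexp (Real.pi * I * ((t:ℂ) ^ 2 + t * w) / a) =
      Real.sqrt a * cexp (Real.pi * I / 4 * (1 - (w:ℂ)^2 / a)) := by
  obtain ⟨C, hC⟩ := vdb_gauss0
  have h1 := hC 1 1 one_pos (by decide)
  simp at h1
  rw [hC a w ha hw]
  have h2 : C = cexp (Real.pi * I / 4) := by
    have := congrArg (fun z => cexp (Real.pi * I / 4) * z) h1
    simp only [mul_one, ← mul_assoc, ← Complex.exp_add] at this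
    rw [this]
    simp
  rw [h2, mul_left_comm, ← Complex.exp_add]
  congr 2
  ring

lemma vdb_orth {n : ℕ} (P : Matrix (Fin n) (Fin n) ℤ) (hsymm : P.IsSymm)
    (hpos : ∀ x : Fin n → ℤ, x ≠ 0 → 0 < x ⬝ᵥ P *ᵥ x) :
    ∃ e : Fin n → (Fin n → ℤ), (∀ i j, i ≠ j → e i ⬝ᵥ P *ᵥ e j = 0) ∧
      (∀ i, 0 < e i ⬝ᵥ P *ᵥ e i) ∧
      ∀ u v : Fin n → ℤ, ∑ i, ((e i ⬝ᵥ P *ᵥ u : ℤ) : ℚ) * ((e i ⬝ᵥ P *ᵥ v : ℤ) : ℚ) /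
        ((e i ⬝ᵥ P *ᵥ e i : ℤ) : ℚ) = ((u ⬝ᵥ P *ᵥ v : ℤ) : ℚ) := by
  let B : LinearMap.BilinForm ℚ (Fin n → ℚ) := Matrix.toBilin' (P.map (Int.cast : ℤ → ℚ))
  have hB : ∀ x y, B x y = x ⬝ᵥ (P.map (Int.cast : ℤ → ℚ)) *ᵥ y := fun x y =>
    Matrix.toBilin'_apply' _ _ _
  have hBs' : ∀ x y, B x y = B y x := by
    intro x y
    rw [hB, hB, Matrix.dotProduct_mulVec, ← Matrix.mulVec_transpose, dotProduct_comm]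
    congr 2
    ext i j
    simpa using congrArg (Int.cast : ℤ → ℚ) (hsymm.apply i j)
  have hBs : LinearMap.IsSymm B := ⟨fun x y => by simpa using hBs' x y⟩
  have hBZ : ∀ x y : Fin n → ℤ, B (fun i => (x i : ℚ)) (fun i => (y i : ℚ)) = ((x ⬝ᵥ P *ᵥ y : ℤ) : ℚ) := by
    intro x y
    rw [hB]
    simp [dotProduct, Matrix.mulVec]
  have : Invertible (2:ℚ) := invertibleOfNonzero (by norm_num)
  obtain ⟨v0, hv0⟩ := LinearMap.BilinForm.exists_orthogonal_basis (B := B) hBs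
  have hfr : Module.finrank ℚ (Fin n → ℚ) = n := by simp
  let v := v0.reindex (finCongr hfr)
  have hv : ∀ i j, i ≠ j → B (v i) (v j) = 0 := by
    intro i j hij
    have := hv0 (i := (finCongr hfr).symm i) (j := (finCongr hfr).symm j) (by simpa using hij)
    simpa [v, Module.Basis.reindex_apply] using this
  have hden : ∀ i, ∃ d : ℤ, d ≠ 0 ∧ ∃ e : Fin n → ℤ, (fun k => (e k : ℚ)) = (d:ℚ) • v i := by
    intro i
    obtain ⟨b, hb⟩ := IsLocalization.exist_integer_multiples_of_finite (nonZeroDivisors ℤ) (fun k => v i k)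
    refine ⟨b, nonZeroDivisors.coe_ne_zero b, ?_⟩
    choose e he using hb
    refine ⟨e, funext fun k => ?_⟩
    have := he k
    simpa [Algebra.smul_def] using this
  choose d hd e he using hden
  have hdQ : ∀ i, (d i : ℚ) ≠ 0 := fun i => by exact_mod_cast hd i
  have hee : ∀ i j, ((e i ⬝ᵥ P *ᵥ e j : ℤ) : ℚ) = d i * d j * B (v i) (v j) := by
    intro i j
    rw [← hBZ, he, he]
    simp
    ring
  have heu : ∀ i u, ((e i ⬝ᵥ P *ᵥ u : ℤ) : ℚ) = d i * B (v i) (fun k => (u k : ℚ)) := by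
    intro i u
    rw [← hBZ, he]
    simp
  have hp : ∀ i, 0 < e i ⬝ᵥ P *ᵥ e i := by
    intro i
    apply hpos
    intro h0
    have h1 := he i
    rw [h0] at h1
    have h2 : (d i : ℚ) • v i = 0 := by rw [← h1]; ext k; simp
    rcases smul_eq_zero.mp h2 with h | h
    · exact hdQ i h
    · exact v.ne_zero i h
  have hb : ∀ i, B (v i) (v i) ≠ 0 := by
    intro i h
    have h1 := hee i i
    rw [h, mul_zero] at h1
    have := hp i
    have h2 : e i ⬝ᵥ P *ᵥ e i = 0 := by exact_mod_cast h1
    omega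
  refine ⟨e, ?_, hp, ?_⟩
  · intro i j hij
    have := hee i j
    rw [hv i j hij, mul_zero] at this
    exact_mod_cast this
  · intro u u'
    have hc : ∀ (x : Fin n → ℚ) i, B (v i) x = v.repr x i * B (v i) (v i) := by
      intro x i
      conv_lhs => rw [← v.sum_repr x]
      rw [map_sum, Finset.sum_eq_single i]
      · simp
      · intro j _ hj
        rw [map_smul, hv i j hj.symm, smul_zero]
      · simp
    rw [← hBZ]
    conv_rhs => rw [← v.sum_repr (fun i => (u i : ℚ))]
    rw [map_sum, LinearMap.sum_apply]
    refine Finset.sum_congr rfl fun i _ => ?_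
    rw [heu, heu, hee, map_smul, LinearMap.smul_apply, hc, hc (fun i => (u' i : ℚ))]
    have := hb i
    have := hdQ i
    simp only [smul_eq_mul]
    field_simp

open Complex in
lemma vdb_key {n : ℕ} (a : Fin n → ℕ) [∀ i, NeZero (a i)] (w : Fin n → ℤ)
    (hw : ∀ i, Even ((a i : ℤ) + w i)) (H : AddSubgroup (∀ i, ZMod (a i)))
    (f : (i : Fin n) → ZMod (a i) → ℂ)
    (hf : ∀ i (t : ℤ), f i (t : ZMod (a i)) = cexp (Real.pi * I * ((t:ℂ) ^ 2 + t * w i) / a i))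
    (hH1 : ∀ y ∈ H, ∏ i, f i (y i) = 1)
    (hH2 : ∀ t : ∀ i, ZMod (a i), (∀ y ∈ H, ∏ i, ZMod.stdAddChar (t i * y i) = 1) → t ∈ H) :
    ∃ c : ℝ, 0 < c ∧ ∏ i, ∑ t ∈ Finset.range (a i), cexp (Real.pi * I * ((t:ℂ) ^ 2 + t * w i) / a i) = c := by
  classical
  have hprod : ∏ i, ∑ t ∈ Finset.range (a i), cexp (Real.pi * I * ((t:ℂ) ^ 2 + t * w i) / a i)
      = ∑ t : (∀ i, ZMod (a i)), ∏ i, f i (t i) := by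
    rw [← Fintype.piFinset_univ, ← Finset.prod_univ_sum]
    refine Finset.prod_congr rfl fun i _ => ?_
    refine Finset.sum_bij (fun t _ => (t : ZMod (a i))) (by simp) ?_ ?_ ?_
    · intro s hs t ht hst
      have := congrArg ZMod.val hst
      rwa [ZMod.val_natCast_of_lt (Finset.mem_range.mp hs), ZMod.val_natCast_of_lt (Finset.mem_range.mp ht)] at this
    · intro b _
      exact ⟨b.val, Finset.mem_range.mpr (ZMod.val_lt b), ZMod.natCast_zmod_val b⟩
    · intro t _
      have := hf i t
      simpa using this.symm
  rw [hprod]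
  set F : (∀ i, ZMod (a i)) → ℂ := fun t => ∏ i, f i (t i) with hF
  have hadd : ∀ i (s t : ZMod (a i)), f i (s + t) = f i s * f i t * ZMod.stdAddChar (s * t) := by
    intro i s t
    obtain ⟨s, rfl⟩ := ZMod.intCast_surjective s
    obtain ⟨t, rfl⟩ := ZMod.intCast_surjective t
    rw [← Int.cast_add, ← Int.cast_mul, hf, hf, hf, ZMod.stdAddChar_coe, ← Complex.exp_add, ← Complex.exp_add]
    congr 1
    push_cast
    ring
  have hFadd : ∀ t, ∀ y ∈ H, F (t + y) = F t * ∏ i, ZMod.stdAddChar (t i * y i) := by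
    intro t y hy
    simp only [hF, Pi.add_apply, hadd, Finset.prod_mul_distrib]
    rw [hH1 y hy, mul_one]
  let χ : (∀ i, ZMod (a i)) → AddChar H ℂ := fun t =>
    { toFun := fun y => ∏ i, ZMod.stdAddChar (t i * (y : ∀ i, ZMod (a i)) i)
      map_zero_eq_one' := by simp
      map_add_eq_mul' := by
        intro x y
        simp [mul_add, AddChar.map_add_eq_mul, Finset.prod_mul_distrib] }
  have hχ : ∀ t (y : H), χ t y = ∏ i, ZMod.stdAddChar (t i * (y : ∀ i, ZMod (a i)) i) := fun _ _ => rfl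
  have hsymm : ∀ t ∈ H, χ t = 0 := by
    intro t ht
    ext y
    have h1 := hFadd t y y.2
    rw [← hχ] at h1
    simp only [hF] at h1
    rw [hH1 _ (H.add_mem ht y.2), hH1 t ht, one_mul] at h1
    simpa using h1.symm
  have hdual : ∀ t, χ t = 0 ↔ t ∈ H := by
    intro t
    refine ⟨fun h => hH2 t fun y hy => ?_, hsymm t⟩
    have := hχ t ⟨y, hy⟩
    rw [h] at this
    simpa using this.symm
  have h1 : (Fintype.card H : ℂ) * ∑ t, F t = ∑ t, F t * ∑ y : H, χ t y := by
    have : ∀ y : H, ∑ t, F (t + y) = ∑ t, F t := fun y => Fintype.sum_equiv (Equiv.addRight (y : ∀ i, ZMod (a i))) _ _ (fun t => rfl)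
    calc (Fintype.card H : ℂ) * ∑ t, F t = ∑ y : H, ∑ t, F (t + y) := by simp [this]
      _ = ∑ t, ∑ y : H, F (t + y) := Finset.sum_comm
      _ = _ := by
        refine Finset.sum_congr rfl fun t _ => ?_
        rw [Finset.mul_sum]
        refine Finset.sum_congr rfl fun y _ => ?_
        rw [hFadd t y y.2, hχ]
  have h2 : ∑ t, F t * ∑ y : H, χ t y = (Fintype.card H : ℂ) * ∑ t : H, 1 := by
    have : ∀ t, F t * ∑ y : H, χ t y = if t ∈ H then (Fintype.card H : ℂ) else 0 := by
      intro t
      rw [AddChar.sum_eq_ite]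
      simp only [hdual]
      split_ifs with h
      · rw [show F t = 1 from hH1 t h, one_mul]
      · simp
    simp_rw [this]
    rw [← Finset.sum_filter, Finset.sum_const, Finset.mul_sum]
    simp [Fintype.card_subtype]
  have hcard : (Fintype.card H : ℂ) ≠ 0 := by
    exact_mod_cast Fintype.card_ne_zero
  have h3 := mul_left_cancel₀ hcard (h1.trans h2)
  refine ⟨Fintype.card H, by exact_mod_cast Fintype.card_pos, ?_⟩
  rw [h3]
  simp

open Complex in
lemma vdb_main {n : ℕ} (P : Matrix (Fin n) (Fin n) ℤ) (hsymm : P.IsSymm)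
    (hpos : ∀ x : Fin n → ℤ, x ≠ 0 → 0 < x ⬝ᵥ P *ᵥ x) (hdet : P.det = 1) (ξ : Fin n → ℤ)
    (hξ : ∀ x : Fin n → ℤ, 2 ∣ (x ⬝ᵥ P *ᵥ ξ - x ⬝ᵥ P *ᵥ x)) :
    (8:ℤ) ∣ n - ξ ⬝ᵥ P *ᵥ ξ := by
  obtain ⟨e, hort, hepos, hpars⟩ := vdb_orth P hsymm hpos
  let a : Fin n → ℕ := fun i => (e i ⬝ᵥ P *ᵥ e i).toNat
  have haZ : ∀ i, (a i : ℤ) = e i ⬝ᵥ P *ᵥ e i := fun i => Int.toNat_of_nonneg (hepos i).le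
  have ha : ∀ i, 0 < a i := fun i => by have := haZ i; have := hepos i; omega
  have : ∀ i, NeZero (a i) := fun i => ⟨(ha i).ne'⟩
  have haC : ∀ i, (a i : ℂ) ≠ 0 := fun i => by exact_mod_cast (ha i).ne'
  let w : Fin n → ℤ := fun i => e i ⬝ᵥ P *ᵥ ξ
  have hw : ∀ i, Even ((a i : ℤ) + w i) := by
    intro i
    have := hξ (e i)
    rw [haZ, even_iff_two_dvd]
    simp only [w]
    omega
  have hparsC : ∀ u v : Fin n → ℤ, ∑ i, ((e i ⬝ᵥ P *ᵥ u : ℤ) : ℂ) * ((e i ⬝ᵥ P *ᵥ v : ℤ) : ℂ) / (a i : ℂ)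
      = ((u ⬝ᵥ P *ᵥ v : ℤ) : ℂ) := by
    intro u v
    have := congrArg (fun q : ℚ => (q : ℂ)) (hpars u v)
    simp only [← haZ] at this
    push_cast at this
    exact this
  let f : (i : Fin n) → ZMod (a i) → ℂ := fun i t =>
    cexp (Real.pi * I * ((t.val:ℂ) ^ 2 + t.val * w i) / a i)
  have hf : ∀ i (t : ℤ), f i (t : ZMod (a i)) = cexp (Real.pi * I * ((t:ℂ) ^ 2 + t * w i) / a i) := by
    intro i t
    simp only [f]
    have h1 : ((t : ZMod (a i)).val : ℤ) = t % (a i) := ZMod.val_intCast t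
    have h2 := Int.emod_add_mul_ediv t (a i)
    rw [← h1] at h2
    set m := (t : ZMod (a i)).val
    set k := t / (a i : ℤ)
    obtain ⟨q, hq⟩ := hw i
    have hqC : (w i : ℂ) = 2 * q - a i := by
      have : ((a i:ℂ) + w i) = q + q := by exact_mod_cast hq
      linear_combination this
    have htC : (t : ℂ) = m + a i * k := by exact_mod_cast h2.symm
    obtain ⟨r, hr⟩ := Int.even_mul_pred_self k
    have hrC : (k:ℂ) * (k - 1) = r + r := by exact_mod_cast hr
    have hr2 : (r:ℂ) = k * (k-1) / 2 := by rw [hrC]; ring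
    rw [exp_eq_exp_iff_exists_int]
    refine ⟨-(m * k + a i * r + k * q), ?_⟩
    push_cast
    rw [htC, hqC, hr2]
    have := haC i
    field_simp
    ring
  let ψ : (Fin n → ℤ) →+ (∀ i, ZMod (a i)) :=
    { toFun := fun v i => ((e i ⬝ᵥ P *ᵥ v : ℤ) : ZMod (a i))
      map_zero' := by ext i; simp
      map_add' := by intro x y; ext i; simp [Matrix.mulVec_add] }
  have hψ : ∀ v i, ψ v i = ((e i ⬝ᵥ P *ᵥ v : ℤ) : ZMod (a i)) := fun _ _ => rfl
  have hH1 : ∀ y ∈ ψ.range, ∏ i, f i (y i) = 1 := by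
    rintro _ ⟨v, rfl⟩
    simp only [hψ, hf]
    rw [← Complex.exp_sum]
    have : ∑ i, Real.pi * I * (((e i ⬝ᵥ P *ᵥ v : ℤ) : ℂ)^2 + ((e i ⬝ᵥ P *ᵥ v : ℤ) : ℂ) * w i) / a i
        = Real.pi * I * (((v ⬝ᵥ P *ᵥ v : ℤ) : ℂ) + ((v ⬝ᵥ P *ᵥ ξ : ℤ) : ℂ)) := by
      rw [← hparsC, ← hparsC, ← Finset.sum_add_distrib, Finset.mul_sum]
      refine Finset.sum_congr rfl fun i _ => ?_
      simp only [w]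
      ring
    rw [this, Complex.exp_eq_one_iff]
    obtain ⟨q, hq⟩ := hξ v
    refine ⟨q + v ⬝ᵥ P *ᵥ v, ?_⟩
    have hq' : ((v ⬝ᵥ P *ᵥ ξ : ℤ) : ℂ) = 2 * q + ((v ⬝ᵥ P *ᵥ v : ℤ) : ℂ) := by
      have : v ⬝ᵥ P *ᵥ ξ = 2 * q + v ⬝ᵥ P *ᵥ v := by omega
      rw [this]; push_cast; ring
    rw [hq']
    push_cast
    ring
  have hH2 : ∀ t : ∀ i, ZMod (a i), (∀ y ∈ ψ.range, ∏ i, ZMod.stdAddChar (t i * y i) = 1) → t ∈ ψ.range := by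
    intro t ht
    choose T hT using fun i => ZMod.intCast_surjective (t i)
    have hex : ∀ v : Fin n → ℤ, ∃ m : ℤ, ∑ i, (T i : ℂ) * ((e i ⬝ᵥ P *ᵥ v : ℤ) : ℂ) / a i = m := by
      intro v
      have h1 := ht (ψ v) ⟨v, rfl⟩
      simp only [← hT, hψ, ← Int.cast_mul, ZMod.stdAddChar_coe] at h1
      rw [← Complex.exp_sum, Complex.exp_eq_one_iff] at h1
      obtain ⟨m, hm⟩ := h1
      refine ⟨m, ?_⟩
      have h2 : (2 * Real.pi * I : ℂ) ≠ 0 := Complex.two_pi_I_ne_zero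
      apply mul_left_cancel₀ h2
      rw [mul_comm _ (m:ℂ), ← hm, Finset.mul_sum]
      refine Finset.sum_congr rfl fun i _ => ?_
      push_cast
      ring
    choose m hm using fun k : Fin n => hex (Pi.single k 1)
    have hPu : P *ᵥ (P⁻¹ *ᵥ m) = m := by
      rw [Matrix.mulVec_mulVec, Matrix.mul_nonsing_inv _ (by rw [hdet]; exact isUnit_one), Matrix.one_mulVec]
    refine ⟨P⁻¹ *ᵥ m, ?_⟩
    ext j
    rw [hψ, hPu, ← hT]
    congr 1
    have hlin : ∀ v : Fin n → ℤ, ((v ⬝ᵥ m : ℤ) : ℂ) = ∑ i, (T i : ℂ) * ((e i ⬝ᵥ P *ᵥ v : ℤ) : ℂ) / a i := by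
      intro v
      have h1 : ∀ i, ((e i ⬝ᵥ P *ᵥ v : ℤ) : ℂ) = ∑ k, (v k : ℂ) * ((e i ⬝ᵥ P *ᵥ Pi.single k 1 : ℤ) : ℂ) := by
        intro i
        rw [Matrix.dotProduct_mulVec]
        simp only [Matrix.dotProduct_mulVec, dotProduct_single, mul_one]
        simp only [dotProduct]
        push_cast
        exact Finset.sum_congr rfl fun k _ => mul_comm _ _
      simp only [h1]
      rw [show v ⬝ᵥ m = ∑ k, v k * m k from rfl]
      push_cast
      simp_rw [← hm, Finset.mul_sum, Finset.sum_div]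
      rw [Finset.sum_comm]
      refine Finset.sum_congr rfl fun i _ => Finset.sum_congr rfl fun k _ => ?_
      ring
    have h2 := hlin (e j)
    rw [Finset.sum_eq_single j] at h2
    · rw [← haZ] at h2
      have := haC j
      push_cast at h2
      rw [mul_div_cancel_right₀ _ this] at h2
      exact_mod_cast h2
    · intro i _ hij
      rw [hort i j hij]
      simp
    · simp
  obtain ⟨c, hc, hprod⟩ := vdb_key a w hw ψ.range f hf hH1 hH2
  simp_rw [vdb_gauss (a _) (w _) (ha _) (hw _)] at hprod
  rw [Finset.prod_mul_distrib, ← Complex.exp_sum] at hprod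
  have hsum : ∑ i, (Real.pi * I / 4 * (1 - (w i : ℂ)^2 / a i)) = Real.pi * I / 4 * ((n:ℂ) - ((ξ ⬝ᵥ P *ᵥ ξ : ℤ) : ℂ)) := by
    rw [← hparsC, ← Finset.mul_sum, Finset.sum_sub_distrib]
    simp only [Finset.sum_const, Finset.card_univ, Fintype.card_fin, nsmul_eq_mul, mul_one]
    simp only [w, sq]
  rw [hsum, ← Complex.ofReal_prod] at hprod
  set s : ℝ := ∏ i, Real.sqrt (a i) with hs
  have hspos : 0 < s := Finset.prod_pos fun i _ => Real.sqrt_pos.mpr (by exact_mod_cast ha i)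
  have hnorm := congrArg norm hprod
  have he1 : ‖cexp (Real.pi * I / 4 * ((n:ℂ) - ((ξ ⬝ᵥ P *ᵥ ξ : ℤ) : ℂ)))‖ = 1 := by
    rw [show (Real.pi * I / 4 * ((n:ℂ) - ((ξ ⬝ᵥ P *ᵥ ξ : ℤ) : ℂ)) : ℂ) =
      ((Real.pi / 4 * ((n:ℝ) - ((ξ ⬝ᵥ P *ᵥ ξ : ℤ) : ℝ)) : ℝ) : ℂ) * I by push_cast; ring, norm_exp_ofReal_mul_I]
  rw [norm_mul, he1, mul_one, Complex.norm_real, Complex.norm_real, Real.norm_of_nonneg hspos.le, Real.norm_of_nonneg hc.le] at hnorm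
  rw [← hnorm] at hprod
  have h1 : cexp (Real.pi * I / 4 * ((n:ℂ) - ((ξ ⬝ᵥ P *ᵥ ξ : ℤ) : ℂ))) = 1 := by
    have : (s:ℂ) ≠ 0 := by exact_mod_cast hspos.ne'
    exact mul_left_cancel₀ this (hprod.trans (mul_one _).symm)
  rw [Complex.exp_eq_one_iff] at h1
  obtain ⟨k, hk⟩ := h1
  refine ⟨k, ?_⟩
  have hpi : (Real.pi * I : ℂ) ≠ 0 := mul_ne_zero (by exact_mod_cast Real.pi_ne_zero) I_ne_zero
  have h2 : (n:ℂ) - ((ξ ⬝ᵥ P *ᵥ ξ : ℤ) : ℂ) = 8 * k := by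
    apply mul_left_cancel₀ hpi
    linear_combination 4 * hk
  exact_mod_cast h2

lemma vdb_block {n s : ℕ} (P : Matrix (Fin n) (Fin n) ℤ) (x y : Fin n ⊕ Fin s → ℤ) :
    x ⬝ᵥ (Matrix.fromBlocks P 0 0 (1 : Matrix (Fin s) (Fin s) ℤ)) *ᵥ y =
      (x ∘ Sum.inl) ⬝ᵥ P *ᵥ (y ∘ Sum.inl) + (x ∘ Sum.inr) ⬝ᵥ (y ∘ Sum.inr) := by
  rw [Matrix.fromBlocks_mulVec]
  simp [dotProduct, Fintype.sum_sum_type]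

/-- Let `L` (Gram matrix `P`) be a unimodular lattice of rank `8k + r`, `0 ≤ r < 8`, with
no vector of norm 1, and let `s ≥ 0`. Then `L ⊥ Iₛ` (whose Gram matrix is the block sum
of `P` and the identity) is exceptional iff `L` is exceptional and `r + s < 8`. -/
theorem orthogonal_sum_with_standard_exceptional_iff
    (k r s : ℕ) (hr : r < 8)
    (P : Matrix (Fin (8 * k + r)) (Fin (8 * k + r)) ℤ)
    (hsymm : P.IsSymm)
    (hpos : ∀ x : Fin (8 * k + r) → ℤ, x ≠ 0 → 0 < x ⬝ᵥ P *ᵥ x)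
    (hdet : P.det = 1)
    (hno1 : ∀ x : Fin (8 * k + r) → ℤ, x ⬝ᵥ P *ᵥ x ≠ 1) :
    IsExceptional (Matrix.fromBlocks P 0 0 (1 : Matrix (Fin s) (Fin s) ℤ)) ↔
      IsExceptional P ∧ r + s < 8 := by
  have hnn : ∀ x : Fin (8 * k + r) → ℤ, 0 ≤ x ⬝ᵥ P *ᵥ x := by
    intro x
    by_cases hx : x = 0
    · simp [hx]
    · exact (hpos x hx).le
  have hmod := vdb_main P hsymm hpos hdet
  push_cast at hmod
  constructor
  · rintro ⟨ξ, hξ, hlt⟩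
    simp only [vdb_block] at hξ hlt
    have hc1 : ∀ x : Fin (8 * k + r) → ℤ, 2 ∣ (x ⬝ᵥ P *ᵥ (ξ ∘ Sum.inl) - x ⬝ᵥ P *ᵥ x) := by
      intro x
      have := hξ (Sum.elim x 0)
      simpa using this
    have hodd : ∀ i, 1 ≤ ξ (Sum.inr i) * ξ (Sum.inr i) := by
      intro i
      have := hξ (Sum.elim 0 (Pi.single i 1))
      simp only [Sum.elim_comp_inl, Sum.elim_comp_inr] at this
      simp at this
      have h0 : ξ (Sum.inr i) ≠ 0 := by
        intro h
        rw [h] at this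
        omega
      nlinarith [mul_self_pos.mpr h0]
    have hs : (s:ℤ) ≤ (ξ ∘ Sum.inr) ⬝ᵥ (ξ ∘ Sum.inr) := by
      have := Finset.sum_le_sum (fun (i : Fin s) (_ : i ∈ Finset.univ) => hodd i)
      simpa [dotProduct] using this
    have h8 := hmod _ hc1
    have h0 := hnn (ξ ∘ Sum.inl)
    refine ⟨⟨ξ ∘ Sum.inl, hc1, by omega⟩, by omega⟩
  · rintro ⟨⟨ξ, hξ, hlt⟩, hrs⟩
    have h8 := hmod _ hξ
    have h0 := hnn ξ
    refine ⟨Sum.elim ξ 1, fun x => ?_, ?_⟩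
    · simp only [vdb_block]
      have h1 := hξ (x ∘ Sum.inl)
      have h2 : 2 ∣ (x ∘ Sum.inr) ⬝ᵥ (1 : Fin s → ℤ) - (x ∘ Sum.inr) ⬝ᵥ (x ∘ Sum.inr) := by
        simp only [dotProduct, ← Finset.sum_sub_distrib]
        refine Finset.dvd_sum fun i _ => ?_
        obtain ⟨q, hq⟩ := Int.even_mul_pred_self (x (Sum.inr i))
        refine ⟨-q, ?_⟩
        simp only [Function.comp, Pi.one_apply]
        linarith
      simp only [Sum.elim_comp_inl, Sum.elim_comp_inr]
      omega
    · simp only [vdb_block, Sum.elim_comp_inl, Sum.elim_comp_inr]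
      simp only [dotProduct_one, Pi.one_apply, Finset.sum_const, Finset.card_univ, Fintype.card_fin, nsmul_eq_mul, mul_one]
      omega
end
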